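/- For distinct x, y ∈ (0, ∞), the logarithmic mean satisfies L(tanh x, tanh y) ≤ tanh((x+y)/2). -/

import Mathlib

noncomputable def logMean (a b : ℝ) : ℝ := (a - b) / (Real.log a - Real.log b)

open Real

theorem aux_tanh (u v : ℝ) (hu : 0 < u) :
    (Real.tanh (u + v) + Real.tanh (u - v)) / 2 ≤ Real.tanh u := by
  have h1 := Real.cosh_pos (u + v)
  have h2 := Real.cosh_pos (u - v)
  have h3 := Real.cosh_pos u
  have h4 := Real.sinh_pos_iff.2 hu
  have e1 := Real.cosh_sq u
  have e2 := Real.cosh_sq v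
  have k1 : Real.cosh (u + v) * Real.cosh (u - v) = Real.cosh u ^ 2 + Real.sinh v ^ 2 := by
    rw [Real.cosh_add, Real.cosh_sub]
    linear_combination (Real.cosh u ^ 2) * e2 + (Real.sinh v ^ 2) * e1
  have k2 : Real.sinh (u + v) * Real.cosh (u - v) + Real.cosh (u + v) * Real.sinh (u - v)
      = 2 * Real.sinh u * Real.cosh u := by
    rw [← Real.sinh_add, ← Real.sinh_two_mul]
    congr 1
    ring
  rw [Real.tanh_eq_sinh_div_cosh, Real.tanh_eq_sinh_div_cosh, Real.tanh_eq_sinh_div_cosh,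
    div_add_div _ _ h1.ne' h2.ne', k2, k1, div_div, div_le_div_iff₀ (by positivity) h3]
  nlinarith [mul_nonneg h4.le (sq_nonneg (Real.sinh v))]

theorem aux_mean (a b : ℝ) (hb : 0 < b) (hab : b < a) : logMean a b ≤ (a + b) / 2 := by
  have ha : 0 < a := hb.trans hab
  have h := Real.le_log_one_add_of_nonneg (x := a / b - 1)
    (by rw [sub_nonneg, one_le_div hb]; exact hab.le)
  have e : 1 + (a / b - 1) = a / b := by ring
  rw [e, Real.log_div ha.ne' hb.ne'] at h
  have e2 : 2 * (a / b - 1) / (a / b - 1 + 2) = 2 * (a - b) / (a + b) := by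
    have : a / b - 1 + 2 = (a + b) / b := by field_simp; ring
    rw [this]
    field_simp
  rw [e2, div_le_iff₀ (by positivity)] at h
  have hl : 0 < Real.log a - Real.log b := sub_pos.2 (Real.log_lt_log hb hab)
  rw [logMean, div_le_iff₀ hl]
  linarith

theorem aux_main (x y : ℝ) (hy : 0 < y) (hxy : y < x) :
    logMean (Real.tanh x) (Real.tanh y) ≤ Real.tanh ((x + y) / 2) := by
  have hb : 0 < Real.tanh y := by
    rw [Real.tanh_eq_sinh_div_cosh]
    exact div_pos (Real.sinh_pos_iff.2 hy) (Real.cosh_pos y)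
  have hab : Real.tanh y < Real.tanh x := by
    rw [Real.tanh_eq_sinh_div_cosh, Real.tanh_eq_sinh_div_cosh,
      div_lt_div_iff₀ (Real.cosh_pos y) (Real.cosh_pos x)]
    have := Real.sinh_pos_iff.2 (sub_pos.2 hxy)
    rw [Real.sinh_sub] at this
    linarith
  refine (aux_mean _ _ hb hab).trans ?_
  have h := aux_tanh ((x + y) / 2) ((x - y) / 2) (by linarith)
  rwa [show (x + y) / 2 + (x - y) / 2 = x by ring,
    show (x + y) / 2 - (x - y) / 2 = y by ring] at h

theorem stmt10 (x y : ℝ) (hx : 0 < x) (hy : 0 < y) (hxy : x ≠ y) :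
    logMean (Real.tanh x) (Real.tanh y) ≤ Real.tanh ((x + y) / 2) := by
  rcases lt_or_gt_of_ne hxy with h | h
  · have := aux_main y x hx h
    rw [add_comm x y]
    have e : logMean (Real.tanh x) (Real.tanh y) = logMean (Real.tanh y) (Real.tanh x) := by
      unfold logMean
      rw [← neg_sub, ← neg_sub (Real.log (Real.tanh y)), neg_div_neg_eq]
    rwa [e]
  · exact aux_main x y hy h
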